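/- Let β > 0 and k < 0 be real numbers, and let Q⁺⁻(k) = {(x,y,z) ∈ ℝ³ : β(x²y²+y²z²+z²x²) + (x²+y²+z²−1/2)² − (1−k)/4 = 0}. Then Q⁺⁻(k) is a nonempty compact connected set homeomorphic to the 2-sphere. -/

import Mathlib

/-- A subset of a real normed space that meets every open ray from the origin exactly once, at a
distance depending continuously on the direction, is homeomorphic to the unit sphere. -/
theorem nonempty_homeomorph_sphere_of_radial {E : Type*} [NormedAddCommGroup E] [NormedSpace ℝ E]
    {r : E → ℝ} (hr : Continuous r) (hpos : ∀ n, 0 < r n) {Q : Set E}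
    (hQ : ∀ n ∈ Metric.sphere (0 : E) 1, ∀ t > 0, t • n ∈ Q ↔ t = r n) (h0 : (0 : E) ∉ Q) :
    Nonempty (↥Q ≃ₜ ↥(Metric.sphere (0 : E) 1)) := by
  have hne : ∀ p : Q, ‖(p : E)‖ ≠ 0 := fun p h => h0 (norm_eq_zero.1 h ▸ p.2)
  have hsphere : ∀ p : Q, ‖(p : E)‖⁻¹ • (p : E) ∈ Metric.sphere (0 : E) 1 := fun p => by
    rw [mem_sphere_zero_iff_norm, norm_smul, norm_inv, norm_norm, inv_mul_cancel₀ (hne p)]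
  refine ⟨⟨⟨fun p => ⟨‖(p : E)‖⁻¹ • (p : E), hsphere p⟩,
    fun n => ⟨r n • (n : E), (hQ n n.2 _ (hpos n)).2 rfl⟩, fun p => ?_, fun n => ?_⟩, ?_, ?_⟩⟩
  · apply Subtype.ext
    have h : ‖(p : E)‖ • ‖(p : E)‖⁻¹ • (p : E) = p := smul_inv_smul₀ (hne p) _
    have h' := (hQ _ (hsphere p) ‖(p : E)‖ (by simpa using norm_ne_zero_iff.1 (hne p))).1
      (h.symm ▸ p.2)
    simp only [← h', h]
  · apply Subtype.ext
    have h : ‖(n : E)‖ = 1 := mem_sphere_zero_iff_norm.1 n.2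
    simp only [norm_smul, h, mul_one, Real.norm_eq_abs, abs_of_pos (hpos _)]
    exact inv_smul_smul₀ (hpos _).ne' _
  · exact Continuous.subtype_mk
      ((continuous_subtype_val.norm.inv₀ hne).smul continuous_subtype_val) _
  · exact Continuous.subtype_mk
      ((hr.comp continuous_subtype_val).smul continuous_subtype_val) _

/-- For `a > 0` and `k < 0`, the biquadratic `a t⁴ - t² + k/4` has exactly one positive root. -/
theorem biquadratic_eq_zero_iff {a k t : ℝ} (ha : 0 < a) (hk : k < 0) (ht : 0 < t) :
    a * t ^ 4 - t ^ 2 + k / 4 = 0 ↔ t = √((1 + √(1 - k * a)) / (2 * a)) := by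
  have hd : 0 < 1 - k * a := by nlinarith
  have hs := Real.sq_sqrt hd.le
  have hs1 : 1 < √(1 - k * a) := by
    rw [Real.lt_sqrt zero_le_one]
    nlinarith
  set s := √(1 - k * a)
  rw [eq_comm (a := t), Real.sqrt_eq_iff_eq_sq (by positivity) ht.le, div_eq_iff (by positivity)]
  have hfac : 4 * a * (a * t ^ 4 - t ^ 2 + k / 4)
      = (t ^ 2 * (2 * a) - 1 - s) * (t ^ 2 * (2 * a) - 1 + s) := by
    linear_combination hs
  have hpos : 0 < t ^ 2 * (2 * a) - 1 + s := by
    have : 0 < t ^ 2 * (2 * a) := by positivity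
    linarith
  constructor
  · intro h
    rw [h, mul_zero, eq_comm, mul_eq_zero] at hfac
    rcases hfac with h | h <;> linarith
  · intro h
    rw [← h, add_sub_cancel_left, sub_self, zero_mul] at hfac
    exact (mul_eq_zero.1 hfac).resolve_left (by positivity)

/-- for `β > 0`, `k < 0`, the quartic `Q⁺⁻(k)`, the zero set of
`β·v + (u - 1/2)² - (1-k)/4`, is a nonempty compact connected set homeomorphic
to the 2-sphere. -/
theorem stmt_9 (β k : ℝ) (hβ : 0 < β) (hk : k < 0)
    (Q : Set (EuclideanSpace ℝ (Fin 3)))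
    (hQ : Q = {p | β * ((p 0)^2*(p 1)^2 + (p 1)^2*(p 2)^2 + (p 2)^2*(p 0)^2)
        + ((p 0)^2 + (p 1)^2 + (p 2)^2 - 1/2)^2 - (1 - k)/4 = 0}) :
    Q.Nonempty ∧ IsCompact Q ∧ IsConnected Q ∧
      Nonempty (↥Q ≃ₜ ↥(Metric.sphere (0 : EuclideanSpace ℝ (Fin 3)) 1)) := by
  let a : EuclideanSpace ℝ (Fin 3) → ℝ := fun p =>
    1 + β * ((p 0)^2*(p 1)^2 + (p 1)^2*(p 2)^2 + (p 2)^2*(p 0)^2)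
  have ha : ∀ p, 0 < a p := fun p => by positivity
  have hac : Continuous a := by fun_prop
  have hhomeo : Nonempty (↥Q ≃ₜ ↥(Metric.sphere (0 : EuclideanSpace ℝ (Fin 3)) 1)) := by
    refine nonempty_homeomorph_sphere_of_radial
      (r := fun p => √((1 + √(1 - k * a p)) / (2 * a p))) ?_ (fun p => ?_) (fun n hn t ht => ?_) ?_
    · exact Real.continuous_sqrt.comp <| Continuous.div (by fun_prop) (by fun_prop)
        fun p => by have := ha p; positivity
    · have := ha p
      positivity
    · rw [← biquadratic_eq_zero_iff (ha n) hk ht, hQ]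
      have hn1 : n 0 ^ 2 + n 1 ^ 2 + n 2 ^ 2 = 1 := by
        rw [mem_sphere_zero_iff_norm] at hn
        have h := EuclideanSpace.real_norm_sq_eq n
        rw [hn, Fin.sum_univ_three] at h
        linarith
      have hu : (t * n 0) ^ 2 + (t * n 1) ^ 2 + (t * n 2) ^ 2 = t ^ 2 := by
        linear_combination t ^ 2 * hn1
      simp only [Set.mem_ofPred_eq, PiLp.smul_apply, smul_eq_mul, hu, a]
      ring_nf
    · rw [hQ]
      simp only [Set.mem_ofPred_eq, PiLp.zero_apply]
      intro h
      linarith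
  obtain ⟨h⟩ := hhomeo
  have hconn : IsConnected (Metric.sphere (0 : EuclideanSpace ℝ (Fin 3)) 1) := by
    refine isConnected_sphere ?_ 0 zero_le_one
    rw [← Module.finrank_eq_rank, finrank_euclideanSpace_fin]
    norm_num
  have : ConnectedSpace ↥(Metric.sphere (0 : EuclideanSpace ℝ (Fin 3)) 1) :=
    isConnected_iff_connectedSpace.1 hconn
  have hQc : IsConnected Q :=
    isConnected_iff_connectedSpace.2 (h.symm.surjective.connectedSpace h.symm.continuous)
  exact ⟨hQc.nonempty, isCompact_iff_compactSpace.2 h.symm.compactSpace, hQc, ⟨h⟩⟩
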